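/- The Selberg integral formula: for every positive integer n and all real numbers α > 0, β > 0, γ ≥ 0, the integral over the cube [0,1]^n of ∏_{i=1}^{n} t_i^{α-1} (1 - t_i)^{β-1} · ∏_{1 ≤ i < j ≤ n} |t_i - t_j|^{2γ} with respect to Lebesgue measure equals ∏_{j=0}^{n-1} [ Γ(α + jγ) Γ(β + jγ) Γ(1 + (j+1)γ) ] / [ Γ(α + β + (n + j - 1)γ) Γ(1 + γ) ], where Γ is the Euler Gamma function. In particular the integrand is integrable on [0,1]^n under these hypotheses. -/

import Mathlib

open MeasureTheory Real

namespace Selberg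

open Filter Topology

/-- Lebesgue measure on the open unit interval. -/
noncomputable def unitMeasure : Measure ℝ := volume.restrict (Set.Ioo 0 1)

/-- Lebesgue measure on the open unit cube. -/
noncomputable def cube (n : ℕ) : Measure (Fin n → ℝ) := Measure.pi fun _ => unitMeasure

/-- The one-variable Beta weight. -/
noncomputable def weight (a b x : ℝ) : ℝ := x ^ (a - 1) * (1 - x) ^ (b - 1)

/-- The product of Beta weights over all coordinates. -/
noncomputable def density (a b : ℝ) {n : ℕ} (t : Fin n → ℝ) : ℝ := ∏ i, weight a b (t i)

/-- The regularised pair interaction; for `ε = 0` it is `|x - y| ^ (2 * c)`. -/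
noncomputable def kernel (ε c x y : ℝ) : ℝ := ((x - y) ^ 2 + ε) ^ c

/-- The regularised power of the Vandermonde product, as a product over ordered pairs. -/
noncomputable def interaction (ε c : ℝ) {n : ℕ} (t : Fin n → ℝ) : ℝ :=
  ∏ i, ∏ j, if i = j then 1 else kernel ε (c / 2) (t i) (t j)

instance : IsFiniteMeasure unitMeasure := by
  unfold unitMeasure; infer_instance

instance (n : ℕ) : IsFiniteMeasure (cube n) := by
  unfold cube; infer_instance

lemma ae_unitMeasure : ∀ᵐ x ∂unitMeasure, x ∈ Set.Ioo (0 : ℝ) 1 :=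
  ae_restrict_mem measurableSet_Ioo

lemma cube_eq (n : ℕ) :
    cube n = volume.restrict (Set.univ.pi fun _ : Fin n => Set.Ioo (0 : ℝ) 1) :=
  (Measure.restrict_pi_pi (fun _ : Fin n => (volume : Measure ℝ)) _).symm

lemma ae_cube (n : ℕ) : ∀ᵐ t ∂cube n, ∀ i, t i ∈ Set.Ioo (0 : ℝ) 1 := by
  rw [cube_eq]
  filter_upwards [ae_restrict_mem (MeasurableSet.univ_pi fun _ => measurableSet_Ioo)] with t ht i
  exact ht i (Set.mem_univ i)

lemma integrable_weight {a b : ℝ} (ha : 0 < a) (hb : 0 < b) :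
    Integrable (weight a b) unitMeasure := by
  have h := Complex.betaIntegral_convergent (u := (a : ℂ)) (v := (b : ℂ)) (by simpa) (by simpa)
  rw [intervalIntegrable_iff_integrableOn_Ioo_of_le zero_le_one] at h
  refine (Integrable.re h).congr ?_
  filter_upwards [ae_unitMeasure] with x hx
  have h1 : (x : ℂ) ^ ((a : ℂ) - 1) * (1 - (x : ℂ)) ^ ((b : ℂ) - 1) = (weight a b x : ℝ) := by
    rw [weight]
    push_cast
    rw [Complex.ofReal_cpow hx.1.le, Complex.ofReal_cpow (by linarith [hx.2])]
    push_cast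
    rfl
  simp only [h1]
  exact Complex.ofReal_re _

lemma integrable_density {a b : ℝ} (ha : 0 < a) (hb : 0 < b) (n : ℕ) :
    Integrable (density a b) (cube n) :=
  Integrable.fintype_prod (f := fun _ : Fin n => weight a b) fun _ => integrable_weight ha hb

lemma kernel_comm (ε c x y : ℝ) : kernel ε c x y = kernel ε c y x := by
  unfold kernel; congr 2; ring

lemma kernel_nonneg {ε : ℝ} (hε : 0 ≤ ε) (c x y : ℝ) : 0 ≤ kernel ε c x y := by
  unfold kernel; positivity

lemma kernel_half_mul_self {ε c : ℝ} (hε : 0 ≤ ε) (hc : 0 ≤ c) (x y : ℝ) :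
    kernel ε (c / 2) x y * kernel ε (c / 2) x y = kernel ε c x y := by
  unfold kernel
  rw [← Real.rpow_add_of_nonneg (by positivity) (by positivity) (by positivity), add_halves]

lemma continuous_kernel {ε c : ℝ} (hc : 0 ≤ c) :
    Continuous fun p : ℝ × ℝ => kernel ε c p.1 p.2 := by
  unfold kernel
  exact Continuous.rpow_const (by fun_prop) fun _ => Or.inr hc

lemma continuous_interaction {ε c : ℝ} (hc : 0 ≤ c) (n : ℕ) :
    Continuous (interaction ε c : (Fin n → ℝ) → ℝ) := by
  unfold interaction
  refine continuous_finsetProd _ fun i _ => continuous_finsetProd _ fun j _ => ?_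
  split_ifs
  · exact continuous_const
  · exact (continuous_kernel (by positivity)).comp
      (by fun_prop : Continuous fun t : Fin n → ℝ => (t i, t j))

lemma interaction_nonneg {ε : ℝ} (hε : 0 ≤ ε) (c : ℝ) {n : ℕ} (t : Fin n → ℝ) :
    0 ≤ interaction ε c t := by
  unfold interaction
  refine Finset.prod_nonneg fun i _ => Finset.prod_nonneg fun j _ => ?_
  split_ifs
  · exact zero_le_one
  · exact kernel_nonneg hε _ _ _

lemma interaction_le {ε c : ℝ} (hε : 0 ≤ ε) (hε1 : ε ≤ 1) (hc : 0 ≤ c) {n : ℕ} {t : Fin n → ℝ}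
    (ht : ∀ i, t i ∈ Set.Ioo (0 : ℝ) 1) :
    interaction ε c t ≤ ∏ _i : Fin n, ∏ _j : Fin n, (2 : ℝ) ^ (c / 2) := by
  unfold interaction
  refine Finset.prod_le_prod (fun i _ => Finset.prod_nonneg fun j _ => ?_) fun i _ =>
    Finset.prod_le_prod (fun j _ => ?_) fun j _ => ?_
  · split_ifs
    · exact zero_le_one
    · exact kernel_nonneg hε _ _ _
  · split_ifs
    · exact zero_le_one
    · exact kernel_nonneg hε _ _ _
  · split_ifs
    · exact Real.one_le_rpow (by norm_num) (by positivity)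
    · refine Real.rpow_le_rpow (by positivity) ?_ (by positivity)
      have := ht i; have := ht j
      simp only [Set.mem_Ioo] at *
      nlinarith

lemma interaction_insertNth {ε c : ℝ} (hε : 0 ≤ ε) (hc : 0 ≤ c) {n : ℕ} (i : Fin (n + 1)) (x : ℝ)
    (y : Fin n → ℝ) :
    interaction ε c (i.insertNth x y : Fin (n + 1) → ℝ) =
      (∏ j, kernel ε c x (y j)) * interaction ε c y := by
  unfold interaction
  rw [Fin.prod_univ_succAbove _ i, Fin.prod_univ_succAbove _ i]
  simp only [Fin.prod_univ_succAbove _ i, Fin.insertNth_apply_same, Fin.insertNth_apply_succAbove,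
    Fin.succAbove_ne, (Fin.succAbove_ne i _).symm, Fin.succAbove_right_inj, if_true, if_false,
    one_mul, Finset.prod_mul_distrib, ← mul_assoc]
  congr 1
  rw [← Finset.prod_mul_distrib]
  exact Finset.prod_congr rfl fun j _ => by
    rw [kernel_comm ε (c / 2) (y j), kernel_half_mul_self hε hc]

lemma density_insertNth (a b : ℝ) {n : ℕ} (i : Fin (n + 1)) (x : ℝ) (y : Fin n → ℝ) :
    density a b (i.insertNth x y : Fin (n + 1) → ℝ) = weight a b x * density a b y := by
  simp [density, Fin.prod_univ_succAbove _ i]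

lemma integral_cube_succ {n : ℕ} (i : Fin (n + 1)) {f : (Fin (n + 1) → ℝ) → ℝ}
    (hf : Integrable f (cube (n + 1))) :
    ∫ t, f t ∂cube (n + 1) = ∫ y, ∫ x, f (i.insertNth x y) ∂unitMeasure ∂cube n := by
  have hm := (measurePreserving_piFinSuccAbove (fun _ : Fin (n + 1) => unitMeasure) i).symm
  unfold cube at *
  rw [← hm.integral_comp' f, integral_prod_symm]
  · rfl
  · exact hm.integrable_comp_of_integrable hf

lemma integral_cube_comp_perm {n : ℕ} (σ : Equiv.Perm (Fin n)) (f : (Fin n → ℝ) → ℝ) :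
    ∫ t, f (t ∘ σ) ∂cube n = ∫ t, f t ∂cube n := by
  have hm := measurePreserving_piCongrLeft (fun _ : Fin n => unitMeasure) σ.symm
  have := hm.integral_comp' f
  unfold cube
  rw [← this]
  refine integral_congr_ae (ae_of_all _ fun t => congrArg f (funext fun k => ?_))
  obtain ⟨j, rfl⟩ := σ.symm.surjective k
  rw [MeasurableEquiv.piCongrLeft_apply_apply, Function.comp_apply, Equiv.apply_symm_apply]

lemma density_comp_perm (a b : ℝ) {n : ℕ} (σ : Equiv.Perm (Fin n)) (t : Fin n → ℝ) :
    density a b (t ∘ σ) = density a b t :=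
  Equiv.prod_comp σ fun i => weight a b (t i)

lemma interaction_comp_perm (ε c : ℝ) {n : ℕ} (σ : Equiv.Perm (Fin n)) (t : Fin n → ℝ) :
    interaction ε c (t ∘ σ) = interaction ε c t := by
  unfold interaction
  rw [← Equiv.prod_comp σ (fun i => ∏ j, if i = j then 1 else kernel ε (c / 2) (t i) (t j))]
  refine Finset.prod_congr rfl fun i _ => ?_
  rw [← Equiv.prod_comp σ (fun j => if σ i = j then 1 else kernel ε (c / 2) (t (σ i)) (t j))]
  simp

lemma exists_bound_of_continuous {n : ℕ} {p : (Fin n → ℝ) → ℝ} (hp : Continuous p) :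
    ∃ C, 0 ≤ C ∧ ∀ t : Fin n → ℝ, (∀ i, t i ∈ Set.Ioo (0 : ℝ) 1) → ‖p t‖ ≤ C := by
  obtain ⟨C, hC⟩ := (isCompact_Icc (a := (0 : Fin n → ℝ)) (b := 1)).exists_bound_of_continuousOn
    hp.continuousOn
  refine ⟨max C 0, le_max_right _ _, fun t ht => (hC t ⟨?_, ?_⟩).trans (le_max_left _ _)⟩
  · exact fun i => (ht i).1.le
  · exact fun i => (ht i).2.le

lemma integrable_mul_density_mul_interaction {a b ε c : ℝ} (ha : 0 < a) (hb : 0 < b)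
    (hc : 0 ≤ c) {n : ℕ} {p : (Fin n → ℝ) → ℝ} (hp : Continuous p) :
    Integrable (fun t => p t * (density a b t * interaction ε c t)) (cube n) := by
  have hq : Continuous fun t => p t * interaction ε c t := hp.mul (continuous_interaction hc n)
  obtain ⟨C, -, hC⟩ := exists_bound_of_continuous hq
  have := (integrable_density ha hb n).bdd_mul (c := C) hq.aestronglyMeasurable
    ((ae_cube n).mono fun t ht => hC t ht)
  refine this.congr (ae_of_all _ fun t => ?_)
  simp only; ring

lemma hasDerivAt_prod_kernel {ε : ℝ} (hε : 0 < ε) (c : ℝ) {n : ℕ} (y : Fin n → ℝ) (x : ℝ) :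
    HasDerivAt (fun x => ∏ j, kernel ε c x (y j))
      ((∑ j, 2 * c * (x - y j) / ((x - y j) ^ 2 + ε)) * ∏ j, kernel ε c x (y j)) x := by
  have h (j : Fin n) : HasDerivAt (fun x => kernel ε c x (y j))
      (2 * c * (x - y j) / ((x - y j) ^ 2 + ε) * kernel ε c x (y j)) x := by
    have hpos : 0 < (x - y j) ^ 2 + ε := by positivity
    have h1 : HasDerivAt (fun x => (x - y j) ^ 2 + ε) (2 * (x - y j)) x := by
      simpa using (((hasDerivAt_id x).sub_const (y j)).pow 2).add_const ε
    refine (h1.rpow_const (p := c) (Or.inl hpos.ne')).congr_deriv ?_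
    rw [Real.rpow_sub_one hpos.ne', kernel]
    ring
  refine (HasDerivAt.fun_finsetProd (u := Finset.univ) fun j _ => h j).congr_deriv ?_
  rw [Finset.sum_mul]
  refine Finset.sum_congr rfl fun j _ => ?_
  rw [← Finset.mul_prod_erase _ _ (Finset.mem_univ j), smul_eq_mul]
  ring

lemma integral_slice {ε c : ℝ} (hε : 0 < ε) (hc : 0 ≤ c) {n : ℕ} (y : Fin n → ℝ) {φ φ' : ℝ → ℝ}
    (hφ : Continuous φ) (hφ' : ∀ x ∈ Set.Ioo (0 : ℝ) 1, HasDerivAt φ (φ' x) x)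
    (hi : Integrable φ' unitMeasure) :
    ∫ x, (φ' x + φ x * ∑ j, 2 * c * (x - y j) / ((x - y j) ^ 2 + ε)) * ∏ j, kernel ε c x (y j)
      ∂unitMeasure =
      φ 1 * ∏ j, kernel ε c 1 (y j) - φ 0 * ∏ j, kernel ε c 0 (y j) := by
  have hD : Continuous fun x => ∏ j, kernel ε c x (y j) :=
    continuous_finsetProd _ fun j _ =>
      (continuous_kernel hc).comp (by fun_prop : Continuous fun x : ℝ => (x, y j))
  have hE : Continuous fun x => ∑ j, 2 * c * (x - y j) / ((x - y j) ^ 2 + ε) :=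
    continuous_finsetSum _ fun j _ =>
      Continuous.div (by fun_prop) (by fun_prop) fun x => by positivity
  have h := intervalIntegral.integral_eq_sub_of_hasDerivAt_of_le (zero_le_one' ℝ)
    (f := fun x => φ x * ∏ j, kernel ε c x (y j))
    (f' := fun x => (φ' x + φ x * ∑ j, 2 * c * (x - y j) / ((x - y j) ^ 2 + ε)) *
      ∏ j, kernel ε c x (y j)) (hφ.mul hD).continuousOn
    (fun x hx => by
      refine ((hφ' x hx).mul (hasDerivAt_prod_kernel hε c y x)).congr_deriv ?_
      ring) ?_
  · rw [← h, intervalIntegral.integral_of_le zero_le_one, integral_Ioc_eq_integral_Ioo]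
    rfl
  · rw [intervalIntegrable_iff_integrableOn_Icc_of_le zero_le_one]
    refine IntegrableOn.mul_continuousOn ?_ hD.continuousOn isCompact_Icc
    refine Integrable.add ?_ ((hφ.mul hE).continuousOn.integrableOn_compact isCompact_Icc)
    exact (integrableOn_Icc_iff_integrableOn_Ioo).2 hi

lemma integral_by_parts {ε c : ℝ} (hε : 0 < ε) (hc : 0 ≤ c) {n : ℕ} (i : Fin (n + 1))
    {φ φ' : ℝ → ℝ} (hφ : Continuous φ) (hφ' : ∀ x ∈ Set.Ioo (0 : ℝ) 1, HasDerivAt φ (φ' x) x)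
    (hi : Integrable φ' unitMeasure) (Q : (Fin n → ℝ) → ℝ)
    (hint : Integrable (fun t : Fin (n + 1) → ℝ =>
      (φ' (t i) + φ (t i) * ∑ j, 2 * c * (t i - t j) / ((t i - t j) ^ 2 + ε)) *
        (Q (i.removeNth t) * interaction ε c t)) (cube (n + 1))) :
    ∫ t : Fin (n + 1) → ℝ,
      (φ' (t i) + φ (t i) * ∑ j, 2 * c * (t i - t j) / ((t i - t j) ^ 2 + ε)) *
        (Q (i.removeNth t) * interaction ε c t) ∂cube (n + 1) =
      ∫ y, (φ 1 * ∏ j, kernel ε c 1 (y j) - φ 0 * ∏ j, kernel ε c 0 (y j)) *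
        (Q y * interaction ε c y) ∂cube n := by
  rw [integral_cube_succ i hint]
  refine integral_congr_ae (ae_of_all _ fun y => ?_)
  simp only
  rw [← integral_slice hε hc y hφ hφ' hi, ← integral_mul_const]
  refine integral_congr_ae (ae_of_all _ fun x => ?_)
  simp only [Fin.removeNth_insertNth, Fin.insertNth_apply_same, interaction_insertNth hε.le hc,
    Fin.sum_univ_succAbove _ i, Fin.insertNth_apply_succAbove, sub_self, mul_zero, zero_div,
    zero_add]
  ring

lemma density_eq_mul_removeNth (a b : ℝ) {n : ℕ} (i : Fin (n + 1)) (t : Fin (n + 1) → ℝ) :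
    density a b t = weight a b (t i) * density a b (i.removeNth t) := by
  conv_lhs => rw [← Fin.insertNth_self_removeNth i t]
  exact density_insertNth a b i _ _

lemma prod_insertNth_removeNth {n : ℕ} {i : Fin (n + 1)} {s : Finset (Fin (n + 1))} (hi : i ∉ s)
    (x : ℝ) (t : Fin (n + 1) → ℝ) :
    ∏ k ∈ s, (i.insertNth x (i.removeNth t) : Fin (n + 1) → ℝ) k = ∏ k ∈ s, t k := by
  refine Finset.prod_congr rfl fun k hk => ?_
  obtain ⟨j, rfl⟩ := Fin.exists_succAbove_eq (show k ≠ i from fun h => hi (h ▸ hk))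
  simp [Fin.removeNth]

lemma integral_divergence_eq_zero {a b ε c : ℝ} (ha : 0 < a) (hb : 0 < b) (hε : 0 < ε)
    (hc : 0 ≤ c) {n : ℕ} {i : Fin (n + 1)} {s : Finset (Fin (n + 1))} (hi : i ∉ s) :
    ∫ t : Fin (n + 1) → ℝ, ((a - (a + b) * t i +
      t i * (1 - t i) * ∑ j, 2 * c * (t i - t j) / ((t i - t j) ^ 2 + ε)) * ∏ k ∈ s, t k) *
        (density a b t * interaction ε c t) ∂cube (n + 1) = 0 := by
  have hφ : Continuous fun x : ℝ => x ^ a * (1 - x) ^ b :=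
    (Continuous.rpow_const (by fun_prop) fun _ => Or.inr ha.le).mul
      (Continuous.rpow_const (by fun_prop) fun _ => Or.inr hb.le)
  have hφ' : ∀ x ∈ Set.Ioo (0 : ℝ) 1, HasDerivAt (fun x : ℝ => x ^ a * (1 - x) ^ b)
      ((a - (a + b) * x) * weight a b x) x := by
    intro x hx
    have hx1 : 1 - x ≠ 0 := by linarith [hx.2]
    have h1 : HasDerivAt (fun x : ℝ => x ^ a) (1 * a * x ^ (a - 1)) x :=
      (hasDerivAt_id x).rpow_const (Or.inl hx.1.ne')
    have h2 : HasDerivAt (fun x : ℝ => (1 - x) ^ b) (-1 * b * (1 - x) ^ (b - 1)) x :=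
      ((hasDerivAt_id x).const_sub 1).rpow_const (Or.inl hx1)
    refine (h1.mul h2).congr_deriv ?_
    rw [weight, Real.rpow_sub_one hx.1.ne', Real.rpow_sub_one hx1]
    have := hx.1.ne'
    field_simp
    ring
  have hi' : Integrable (fun x => (a - (a + b) * x) * weight a b x) unitMeasure := by
    refine (integrable_weight ha hb).bdd_mul (c := a + (a + b)) (by fun_prop) ?_
    filter_upwards [ae_unitMeasure] with x hx
    rw [Real.norm_eq_abs, abs_le]
    constructor <;> nlinarith [hx.1, hx.2]
  have hcont : Continuous fun t : Fin (n + 1) → ℝ => (a - (a + b) * t i +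
      t i * (1 - t i) * ∑ j, 2 * c * (t i - t j) / ((t i - t j) ^ 2 + ε)) * ∏ k ∈ s, t k := by
    refine Continuous.mul (Continuous.add (by fun_prop) (Continuous.mul (by fun_prop) ?_))
      (by fun_prop)
    exact continuous_finsetSum _ fun j _ =>
      Continuous.div (by fun_prop) (by fun_prop) fun x => by positivity
  have hint := integrable_mul_density_mul_interaction (ε := ε) ha hb hc hcont
  obtain ⟨Q, hQ⟩ : ∃ Q : (Fin n → ℝ) → ℝ, ∀ y, Q y =
      (∏ k ∈ s, (i.insertNth 0 y : Fin (n + 1) → ℝ) k) * density a b y := ⟨_, fun _ => rfl⟩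
  have hae : (fun t : Fin (n + 1) → ℝ => ((a - (a + b) * t i +
      t i * (1 - t i) * ∑ j, 2 * c * (t i - t j) / ((t i - t j) ^ 2 + ε)) * ∏ k ∈ s, t k) *
        (density a b t * interaction ε c t)) =ᵐ[cube (n + 1)] fun t =>
      ((a - (a + b) * t i) * weight a b (t i) + t i ^ a * (1 - t i) ^ b *
        ∑ j, 2 * c * (t i - t j) / ((t i - t j) ^ 2 + ε)) *
        (Q (i.removeNth t) * interaction ε c t) := by
    filter_upwards [ae_cube (n + 1)] with t ht
    have hx := ht i
    have hx1 : 1 - t i ≠ 0 := by linarith [hx.2]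
    have h : t i ^ a * (1 - t i) ^ b = t i * (1 - t i) * weight a b (t i) := by
      rw [weight, Real.rpow_sub_one hx.1.ne', Real.rpow_sub_one hx1]
      have := hx.1.ne'
      field_simp
    rw [hQ, prod_insertNth_removeNth hi, h, density_eq_mul_removeNth a b i]
    ring
  rw [integral_congr_ae hae,
    integral_by_parts hε hc i hφ hφ' hi' Q (hint.congr hae)]
  simp [Real.zero_rpow ha.ne', Real.zero_rpow hb.ne']

lemma integral_boundary {a ε c : ℝ} (ha : 0 < a) (hε : 0 < ε)
    (hc : 0 ≤ c) {n : ℕ} (i : Fin (n + 1)) :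
    ∫ t : Fin (n + 1) → ℝ, (a + t i * ∑ j, 2 * c * (t i - t j) / ((t i - t j) ^ 2 + ε)) *
        (density a 1 t * interaction ε c t) ∂cube (n + 1) =
      ∫ y : Fin n → ℝ, (∏ j, kernel ε c 1 (y j)) * (density a 1 y * interaction ε c y)
        ∂cube n := by
  have hφ : Continuous fun x : ℝ => x ^ a :=
    (Continuous.rpow_const (by fun_prop) fun _ => Or.inr ha.le)
  have hφ' : ∀ x ∈ Set.Ioo (0 : ℝ) 1, HasDerivAt (fun x : ℝ => x ^ a)
      (a * weight a 1 x) x := by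
    intro x hx
    have h1 : HasDerivAt (fun x : ℝ => x ^ a) (1 * a * x ^ (a - 1)) x :=
      (hasDerivAt_id x).rpow_const (Or.inl hx.1.ne')
    refine h1.congr_deriv ?_
    simp [weight]
  have hi' : Integrable (fun x => a * weight a 1 x) unitMeasure :=
    (integrable_weight ha one_pos).const_mul a
  have hcont : Continuous fun t : Fin (n + 1) → ℝ =>
      a + t i * ∑ j, 2 * c * (t i - t j) / ((t i - t j) ^ 2 + ε) := by
    refine Continuous.add (by fun_prop) (Continuous.mul (by fun_prop) ?_)
    exact continuous_finsetSum _ fun j _ =>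
      Continuous.div (by fun_prop) (by fun_prop) fun x => by positivity
  have hint := integrable_mul_density_mul_interaction (ε := ε) ha one_pos hc hcont
  have hae : (fun t : Fin (n + 1) → ℝ =>
      (a + t i * ∑ j, 2 * c * (t i - t j) / ((t i - t j) ^ 2 + ε)) *
        (density a 1 t * interaction ε c t)) =ᵐ[cube (n + 1)] fun t =>
      (a * weight a 1 (t i) + t i ^ a *
        ∑ j, 2 * c * (t i - t j) / ((t i - t j) ^ 2 + ε)) *
        (density a 1 (i.removeNth t) * interaction ε c t) := by
    filter_upwards [ae_cube (n + 1)] with t ht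
    have hx := ht i
    have h : t i ^ a = t i * weight a 1 (t i) := by
      rw [weight, Real.rpow_sub_one hx.1.ne']
      have := hx.1.ne'
      simp
      field_simp
    rw [h, density_eq_mul_removeNth a 1 i]
    ring
  rw [integral_congr_ae hae,
    integral_by_parts hε hc i hφ hφ' hi' _ (hint.congr hae)]
  simp [Real.zero_rpow ha.ne']

lemma integral_add_swap {n : ℕ} (i j : Fin n) {f g : (Fin n → ℝ) → ℝ}
    (hf : Integrable f (cube n)) (h : ∀ t, f t + f (t ∘ Equiv.swap i j) = 2 * g t) :
    ∫ t, f t ∂cube n = ∫ t, g t ∂cube n := by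
  have h1 := integral_cube_comp_perm (Equiv.swap i j) f
  have hf' : Integrable (fun t => f (t ∘ Equiv.swap i j)) (cube n) := by
    have hm := measurePreserving_piCongrLeft (fun _ : Fin n => unitMeasure) (Equiv.swap i j).symm
    refine (hm.integrable_comp_of_integrable hf).congr
      (ae_of_all _ fun t => congrArg f (funext fun k => ?_))
    obtain ⟨l, rfl⟩ := (Equiv.swap i j).symm.surjective k
    rw [MeasurableEquiv.piCongrLeft_apply_apply, Function.comp_apply, Equiv.apply_symm_apply]
  have h2 := integral_add hf hf'
  simp only [h, integral_const_mul] at h2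
  linarith

lemma prod_comp_swap_of_notMem {n : ℕ} {i j : Fin n} {s : Finset (Fin n)} (hi : i ∉ s) (hj : j ∉ s)
    (t : Fin n → ℝ) : ∏ k ∈ s, (t ∘ Equiv.swap i j) k = ∏ k ∈ s, t k := by
  refine Finset.prod_congr rfl fun k hk => ?_
  rw [Function.comp_apply, Equiv.swap_apply_of_ne_of_ne] <;> rintro rfl <;> contradiction

lemma integral_interaction_term {a b ε c : ℝ} (ha : 0 < a) (hb : 0 < b) (hε : 0 < ε)
    (hc : 0 ≤ c) {n : ℕ} {i : Fin n} {s : Finset (Fin n)} (hi : i ∉ s) (j : Fin n) :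
    ∫ t : Fin n → ℝ, (t i * (1 - t i) * (2 * c * (t i - t j) / ((t i - t j) ^ 2 + ε)) *
      ∏ k ∈ s, t k) * (density a b t * interaction ε c t) ∂cube n =
    c * ∫ t : Fin n → ℝ, (t i - t j) ^ 2 / ((t i - t j) ^ 2 + ε) *
      ((if j ∈ s then -∏ k ∈ insert i s, t k else (1 - t i - t j) * ∏ k ∈ s, t k) *
        (density a b t * interaction ε c t)) ∂cube n := by
  rw [← integral_const_mul]
  refine integral_add_swap i j ?_ fun t => ?_
  · refine integrable_mul_density_mul_interaction ha hb hc ?_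
    exact ((by fun_prop : Continuous fun t : Fin n → ℝ => t i * (1 - t i)).mul
      (Continuous.div (by fun_prop) (by fun_prop) fun x => by positivity)).mul (by fun_prop)
  · have hne : (t i - t j) ^ 2 + ε ≠ 0 := by positivity
    have hne' : (t j - t i) ^ 2 + ε = (t i - t j) ^ 2 + ε := by ring
    rw [density_comp_perm, interaction_comp_perm]
    split_ifs with hj
    · have h1 : i ∉ s.erase j := fun h => hi (Finset.mem_of_mem_erase h)
      rw [Finset.prod_insert hi, ← Finset.mul_prod_erase s _ hj, ← Finset.mul_prod_erase s _ hj,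
        prod_comp_swap_of_notMem h1 (Finset.notMem_erase j s)]
      simp only [Function.comp_apply, Equiv.swap_apply_left, Equiv.swap_apply_right, hne']
      field_simp
      ring
    · rw [prod_comp_swap_of_notMem hi hj]
      simp only [Function.comp_apply, Equiv.swap_apply_left, Equiv.swap_apply_right, hne']
      field_simp
      ring

lemma integral_boundary_term {a ε c : ℝ} (ha : 0 < a) (hε : 0 < ε)
    (hc : 0 ≤ c) {n : ℕ} (i j : Fin n) :
    ∫ t : Fin n → ℝ, (t i * (2 * c * (t i - t j) / ((t i - t j) ^ 2 + ε))) *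
      (density a 1 t * interaction ε c t) ∂cube n =
    c * ∫ t : Fin n → ℝ, (t i - t j) ^ 2 / ((t i - t j) ^ 2 + ε) *
      (1 * (density a 1 t * interaction ε c t)) ∂cube n := by
  rw [← integral_const_mul]
  refine integral_add_swap i j ?_ fun t => ?_
  · refine integrable_mul_density_mul_interaction ha one_pos hc ?_
    exact (by fun_prop : Continuous fun t : Fin n → ℝ => t i).mul
      (Continuous.div (by fun_prop) (by fun_prop) fun x => by positivity)
  · have hne : (t i - t j) ^ 2 + ε ≠ 0 := by positivity
    have hne' : (t j - t i) ^ 2 + ε = (t i - t j) ^ 2 + ε := by ring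
    rw [density_comp_perm, interaction_comp_perm]
    simp only [Function.comp_apply, Equiv.swap_apply_left, Equiv.swap_apply_right, hne']
    field_simp
    ring

lemma continuous_interaction_epsilon {c : ℝ} (hc : 0 ≤ c) {n : ℕ} (t : Fin n → ℝ) :
    Continuous fun ε => interaction ε c t := by
  unfold interaction
  refine continuous_finsetProd _ fun i _ => continuous_finsetProd _ fun j _ => ?_
  split_ifs
  · exact continuous_const
  · exact Continuous.rpow_const (by fun_prop) fun _ => Or.inr (by positivity)

lemma tendsto_integral_interaction {a b c C : ℝ} (ha : 0 < a) (hb : 0 < b) (hc : 0 ≤ c) {n : ℕ}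
    {p : (Fin n → ℝ) → ℝ} (hp : Continuous p) {u : ℝ → (Fin n → ℝ) → ℝ} {v : (Fin n → ℝ) → ℝ}
    (hu : ∀ ε, 0 < ε → Continuous (u ε))
    (hC : ∀ ε, 0 < ε → ε ≤ 1 → ∀ t : Fin n → ℝ, (∀ i, t i ∈ Set.Ioo (0 : ℝ) 1) → |u ε t| ≤ C)
    (hlim : ∀ t, Tendsto (fun ε => u ε t * interaction ε c t) (𝓝[>] 0)
      (𝓝 (v t * interaction 0 c t))) :
    Tendsto (fun ε => ∫ t, u ε t * (p t * (density a b t * interaction ε c t)) ∂cube n) (𝓝[>] 0)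
      (𝓝 (∫ t, v t * (p t * (density a b t * interaction 0 c t)) ∂cube n)) := by
  obtain ⟨B, hB0, hB⟩ := exists_bound_of_continuous hp
  set M : ℝ := ∏ _i : Fin n, ∏ _j : Fin n, (2 : ℝ) ^ (c / 2)
  have hsmall : ∀ᶠ ε : ℝ in 𝓝[>] 0, 0 < ε ∧ ε ≤ 1 := by
    filter_upwards [Ioo_mem_nhdsGT (zero_lt_one' ℝ)] with ε hε using ⟨hε.1, hε.2.le⟩
  refine tendsto_integral_filter_of_dominated_convergence
    (fun t => (|C| * B * M) * ‖density a b t‖) ?_ ?_ ?_ ?_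
  · filter_upwards [hsmall] with ε hε
    exact (hu ε hε.1).aestronglyMeasurable.mul
      (integrable_mul_density_mul_interaction ha hb hc hp).aestronglyMeasurable
  · filter_upwards [hsmall] with ε hε
    filter_upwards [ae_cube n] with t ht
    have h1 : ‖u ε t‖ ≤ |C| := (hC ε hε.1 hε.2 t ht).trans (le_abs_self C)
    have h2 := hB t ht
    have h3 : ‖interaction ε c t‖ ≤ M := by
      rw [Real.norm_of_nonneg (interaction_nonneg hε.1.le c t)]
      exact interaction_le hε.1.le hε.2 hc ht
    calc ‖u ε t * (p t * (density a b t * interaction ε c t))‖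
        = ‖u ε t‖ * ‖p t‖ * ‖interaction ε c t‖ * ‖density a b t‖ := by
          simp only [norm_mul]; ring
      _ ≤ |C| * B * M * ‖density a b t‖ := by gcongr
  · exact (integrable_density ha hb n).norm.const_mul _
  · refine ae_of_all _ fun t => ?_
    have := (hlim t).mul_const (p t * density a b t)
    convert this using 2 <;> ring

lemma tendsto_integral_interaction_const {a b c : ℝ} (ha : 0 < a) (hb : 0 < b) (hc : 0 ≤ c) {n : ℕ}
    {p : (Fin n → ℝ) → ℝ} (hp : Continuous p) :
    Tendsto (fun ε => ∫ t, p t * (density a b t * interaction ε c t) ∂cube n) (𝓝[>] 0)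
      (𝓝 (∫ t, p t * (density a b t * interaction 0 c t) ∂cube n)) := by
  have := tendsto_integral_interaction (C := 1) ha hb hc hp (u := fun _ _ => 1) (v := fun _ => 1)
    (fun _ _ => continuous_const) (by simp) fun t => by
      simpa using ((continuous_interaction_epsilon hc t).tendsto 0).mono_left nhdsWithin_le_nhds
  simpa using this

lemma tendsto_integral_interaction_ratio {a b c : ℝ} (ha : 0 < a) (hb : 0 < b) (hc : 0 ≤ c) {n : ℕ}
    {p : (Fin n → ℝ) → ℝ} (hp : Continuous p) {i j : Fin n} (hij : i ≠ j) :
    Tendsto (fun ε => c * ∫ t, (t i - t j) ^ 2 / ((t i - t j) ^ 2 + ε) *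
        (p t * (density a b t * interaction ε c t)) ∂cube n) (𝓝[>] 0)
      (𝓝 (c * ∫ t, p t * (density a b t * interaction 0 c t) ∂cube n)) := by
  rcases hc.eq_or_lt with rfl | hc'
  · simp
  refine Tendsto.const_mul c ?_
  have := tendsto_integral_interaction (C := 1) ha hb hc hp
    (u := fun ε t => (t i - t j) ^ 2 / ((t i - t j) ^ 2 + ε)) (v := fun _ => 1)
    (fun ε hε => Continuous.div (by fun_prop) (by fun_prop) fun x => by positivity)
    (fun ε hε _ t _ => by
      rw [abs_of_nonneg (by positivity)]
      exact div_le_one_of_le₀ (by linarith) (by positivity)) fun t => by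
    have h := ((continuous_interaction_epsilon hc t).tendsto 0).mono_left
      (nhdsWithin_le_nhds (s := Set.Ioi 0))
    by_cases ht : t i = t j
    · have h0 : interaction 0 c t = 0 := by
        unfold interaction
        refine Finset.prod_eq_zero (Finset.mem_univ i)
          (Finset.prod_eq_zero (Finset.mem_univ j) ?_)
        simp [hij, kernel, ht, hc'.ne']
      simp [ht, h0]
    · refine Tendsto.mul ?_ h
      have hne : (t i - t j) ^ 2 ≠ 0 := pow_ne_zero 2 (sub_ne_zero.2 ht)
      have h1 : Tendsto (fun ε : ℝ => (t i - t j) ^ 2 / ((t i - t j) ^ 2 + ε)) (𝓝 0)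
          (𝓝 ((t i - t j) ^ 2 / ((t i - t j) ^ 2 + 0))) :=
        tendsto_const_nhds.div (tendsto_const_nhds.add tendsto_id) (by simpa using hne)
      rw [add_zero, div_self hne] at h1
      exact h1.mono_left nhdsWithin_le_nhds
  simpa using this

/-- The Selberg integral with an additional monomial factor in the coordinates of `s`. -/
noncomputable def momentIntegral (a b c : ℝ) {n : ℕ} (s : Finset (Fin n)) : ℝ :=
  ∫ t, (∏ k ∈ s, t k) * (density a b t * interaction 0 c t) ∂cube n

/-- The Selberg integral. -/
noncomputable def selbergIntegral (n : ℕ) (a b c : ℝ) : ℝ :=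
  ∫ t : Fin n → ℝ, density a b t * interaction 0 c t ∂cube n

lemma momentIntegral_empty (a b c : ℝ) (n : ℕ) :
    momentIntegral a b c (∅ : Finset (Fin n)) = selbergIntegral n a b c := by
  simp [momentIntegral, selbergIntegral]

lemma momentIntegral_univ (a b c : ℝ) (n : ℕ) :
    momentIntegral a b c (Finset.univ : Finset (Fin n)) = selbergIntegral n (a + 1) b c := by
  unfold momentIntegral selbergIntegral
  refine integral_congr_ae ?_
  filter_upwards [ae_cube n] with t ht
  rw [← mul_assoc]
  congr 1
  unfold density
  rw [← Finset.prod_mul_distrib]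
  refine Finset.prod_congr rfl fun i _ => ?_
  have := (ht i).1.ne'
  rw [weight, weight, Real.rpow_sub_one this, add_sub_cancel_right]
  field_simp

lemma momentIntegral_insert_swap (a b c : ℝ) {n : ℕ} {s : Finset (Fin n)} {i j : Fin n}
    (hi : i ∉ s) (hj : j ∉ s) :
    momentIntegral a b c (insert j s) = momentIntegral a b c (insert i s) := by
  unfold momentIntegral
  rw [← integral_cube_comp_perm (Equiv.swap i j)]
  refine integral_congr_ae (ae_of_all _ fun t => ?_)
  simp only [density_comp_perm, interaction_comp_perm, Finset.prod_insert hi,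
    Finset.prod_insert hj, prod_comp_swap_of_notMem hi hj]
  simp

/-- **Aomoto's recurrence**. -/
lemma momentIntegral_insert {a b c : ℝ} (ha : 0 < a) (hb : 0 < b) (hc : 0 ≤ c) {n : ℕ}
    {i : Fin (n + 1)} {s : Finset (Fin (n + 1))} (hi : i ∉ s) :
    (a + (n - s.card) * c) * momentIntegral a b c s =
      (a + b + (2 * n - s.card) * c) * momentIntegral a b c (insert i s) := by
  have hint (p : (Fin (n + 1) → ℝ) → ℝ) (hp : Continuous p) (ε : ℝ) :=
    integrable_mul_density_mul_interaction (ε := ε) ha hb hc hp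
  set q : Fin (n + 1) → (Fin (n + 1) → ℝ) → ℝ := fun j t =>
    if j ∈ s then -∏ k ∈ insert i s, t k else (1 - t i - t j) * ∏ k ∈ s, t k with hq
  have hqc (j) : Continuous (q j) := by
    by_cases hj : j ∈ s <;> simp only [hq, hj, if_true, if_false] <;> fun_prop
  have hT (ε : ℝ) (hε : 0 < ε) (j) : Continuous fun t : Fin (n + 1) → ℝ =>
      t i * (1 - t i) * (2 * c * (t i - t j) / ((t i - t j) ^ 2 + ε)) * ∏ k ∈ s, t k :=
    ((by fun_prop : Continuous fun t : Fin (n + 1) → ℝ => t i * (1 - t i)).mul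
      (Continuous.div (by fun_prop) (by fun_prop) fun x => by positivity)).mul (by fun_prop)
  have hzero : ∀ ε : ℝ, 0 < ε →
      (∫ t : Fin (n + 1) → ℝ, ((a - (a + b) * t i) * ∏ k ∈ s, t k) *
        (density a b t * interaction ε c t) ∂cube (n + 1)) +
      ∑ j ∈ Finset.univ.erase i, c * ∫ t : Fin (n + 1) → ℝ,
        (t i - t j) ^ 2 / ((t i - t j) ^ 2 + ε) *
          (q j t * (density a b t * interaction ε c t)) ∂cube (n + 1) = 0 := by
    intro ε hε
    rw [Finset.sum_erase _ (by simp), ← integral_divergence_eq_zero ha hb hε hc hi]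
    simp only [hq, ← integral_interaction_term ha hb hε hc hi]
    rw [← integral_finsetSum _ fun j _ => hint _ (hT ε hε j) ε,
      ← integral_add (hint _ (by fun_prop) ε)
        (integrable_finsetSum _ fun j _ => hint _ (hT ε hε j) ε)]
    refine integral_congr_ae (ae_of_all _ fun t => ?_)
    simp only [← Finset.sum_mul, ← Finset.mul_sum]
    ring
  have hlim := (tendsto_integral_interaction_const ha hb hc
    (p := fun t : Fin (n + 1) → ℝ => (a - (a + b) * t i) * ∏ k ∈ s, t k) (by fun_prop)).add
    (tendsto_finsetSum (Finset.univ.erase i) fun j hj =>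
      tendsto_integral_interaction_ratio ha hb hc (hqc j) (Finset.ne_of_mem_erase hj).symm)
  have h0 := tendsto_nhds_unique hlim ((tendsto_const_nhds (x := (0 : ℝ))).congr' (by
    filter_upwards [self_mem_nhdsWithin] with ε hε using (hzero ε hε).symm))
  have h1 : ∫ t : Fin (n + 1) → ℝ, ((a - (a + b) * t i) * ∏ k ∈ s, t k) *
        (density a b t * interaction 0 c t) ∂cube (n + 1) =
      a * momentIntegral a b c s - (a + b) * momentIntegral a b c (insert i s) := by
    unfold momentIntegral
    rw [← integral_const_mul, ← integral_const_mul, ← integral_sub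
      ((hint _ (by fun_prop) 0).const_mul a) ((hint _ (by fun_prop) 0).const_mul (a + b))]
    refine integral_congr_ae (ae_of_all _ fun t => ?_)
    simp only [Finset.prod_insert hi]
    ring
  have h2 : ∀ j ∈ Finset.univ.erase i, c * ∫ t : Fin (n + 1) → ℝ,
      q j t * (density a b t * interaction 0 c t) ∂cube (n + 1) =
      if j ∈ s then -(c * momentIntegral a b c (insert i s)) else
        c * (momentIntegral a b c s - 2 * momentIntegral a b c (insert i s)) := by
    intro j _
    split_ifs with hj
    · simp [hq, hj, momentIntegral, integral_neg]
    · congr 1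
      have hs := momentIntegral_insert_swap a b c hi hj
      rw [two_mul]
      nth_rewrite 2 [← hs]
      unfold momentIntegral
      have hm (r : Finset (Fin (n + 1))) := hint (fun t => ∏ k ∈ r, t k) (by fun_prop) 0
      have e := integral_sub ((hm s).sub (hm (insert i s))) (hm (insert j s))
      simp only [Pi.sub_apply] at e
      rw [← sub_sub, ← integral_sub (hm s) (hm (insert i s)), ← e]
      refine integral_congr_ae (ae_of_all _ fun t => ?_)
      simp only [hq, hj, if_false, Finset.prod_insert hi, Finset.prod_insert hj]
      ring
  rw [h1, Finset.sum_congr rfl h2, Finset.sum_ite, Finset.sum_const, Finset.sum_const] at h0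
  have hf1 : (Finset.univ.erase i).filter (· ∈ s) = s := by
    ext j
    simp only [Finset.mem_filter, Finset.mem_erase, Finset.mem_univ, and_true,
      and_iff_right_iff_imp]
    rintro hj rfl
    exact hi hj
  have hcard := Finset.card_filter_add_card_filter_not (s := Finset.univ.erase i) (· ∈ s)
  rw [hf1, Finset.card_erase_of_mem (Finset.mem_univ i), Finset.card_univ, Fintype.card_fin,
    Nat.add_sub_cancel] at hcard
  rw [hf1] at h0
  have hcard' : (((Finset.univ.erase i).filter (¬ · ∈ s)).card : ℝ) = n - s.card := by
    rw [eq_sub_iff_add_eq']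
    exact_mod_cast hcard
  simp only [nsmul_eq_mul, hcard'] at h0
  linear_combination h0

lemma selbergIntegral_succ_one {a c : ℝ} (ha : 0 < a) (hc : 0 ≤ c) (n : ℕ) :
    (a + n * c) * selbergIntegral (n + 1) a 1 c = selbergIntegral n a (1 + 2 * c) c := by
  have hint (p : (Fin (n + 1) → ℝ) → ℝ) (hp : Continuous p) (ε : ℝ) :=
    integrable_mul_density_mul_interaction (ε := ε) ha one_pos hc hp
  have hT (ε : ℝ) (hε : 0 < ε) (j) : Continuous fun t : Fin (n + 1) → ℝ =>
      t 0 * (2 * c * (t 0 - t j) / ((t 0 - t j) ^ 2 + ε)) :=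
    (by fun_prop : Continuous fun t : Fin (n + 1) → ℝ => t 0).mul
      (Continuous.div (by fun_prop) (by fun_prop) fun x => by positivity)
  have hparts : ∀ ε : ℝ, 0 < ε →
      (∫ t : Fin (n + 1) → ℝ, a * (density a 1 t * interaction ε c t) ∂cube (n + 1)) +
      ∑ j ∈ Finset.univ.erase 0, c * ∫ t : Fin (n + 1) → ℝ,
        (t 0 - t j) ^ 2 / ((t 0 - t j) ^ 2 + ε) *
          (1 * (density a 1 t * interaction ε c t)) ∂cube (n + 1) =
      ∫ y : Fin n → ℝ, (∏ j, kernel ε c 1 (y j)) * (1 * (density a 1 y * interaction ε c y))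
        ∂cube n := by
    intro ε hε
    simp only [one_mul]
    rw [Finset.sum_erase _ (by simp), ← integral_boundary ha hε hc 0]
    have := fun j => integral_boundary_term (n := n + 1) ha hε hc 0 j
    simp only [one_mul] at this
    simp only [← this]
    rw [← integral_finsetSum _ fun j _ => hint _ (hT ε hε j) ε, ← integral_add
      (hint _ (by fun_prop) ε) (integrable_finsetSum _ fun j _ => hint _ (hT ε hε j) ε)]
    refine integral_congr_ae (ae_of_all _ fun t => ?_)
    simp only [← Finset.sum_mul, ← Finset.mul_sum]
    ring
  have hlim := (tendsto_integral_interaction_const ha one_pos hc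
    (p := fun _ : Fin (n + 1) → ℝ => a) (by fun_prop)).add
    (tendsto_finsetSum (Finset.univ.erase (0 : Fin (n + 1))) fun j hj =>
      tendsto_integral_interaction_ratio ha one_pos hc (p := fun _ => 1) continuous_const
        (Finset.ne_of_mem_erase hj).symm)
  have hlim' := tendsto_integral_interaction (C := ∏ _j : Fin n, (2 : ℝ) ^ c) ha one_pos hc
    (p := fun _ : Fin n → ℝ => 1) continuous_const
    (u := fun ε y => ∏ j, kernel ε c 1 (y j)) (v := fun y => ∏ j, kernel 0 c 1 (y j))
    (fun ε _ => continuous_finsetProd _ fun j _ =>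
      (continuous_kernel hc).comp (by fun_prop : Continuous fun y : Fin n → ℝ => ((1 : ℝ), y j)))
    (fun ε hε hε1 t ht => by
      rw [abs_of_nonneg (Finset.prod_nonneg fun j _ => kernel_nonneg hε.le _ _ _)]
      refine Finset.prod_le_prod (fun j _ => kernel_nonneg hε.le _ _ _) fun j _ => ?_
      refine Real.rpow_le_rpow (by positivity) ?_ hc
      have := ht j
      simp only [Set.mem_Ioo] at this
      nlinarith)
    (fun t => by
      refine Tendsto.mono_left (Continuous.tendsto ?_ 0) nhdsWithin_le_nhds
      exact (continuous_finsetProd _ fun j _ =>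
        Continuous.rpow_const (by fun_prop) fun _ => Or.inr hc).mul
          (continuous_interaction_epsilon hc t))
  have h0 := tendsto_nhds_unique hlim (hlim'.congr' (by
    filter_upwards [self_mem_nhdsWithin] with ε hε using (hparts ε hε).symm))
  have h1 : ∫ t : Fin n → ℝ, (∏ j, kernel 0 c 1 (t j)) *
      (1 * (density a 1 t * interaction 0 c t)) ∂cube n = selbergIntegral n a (1 + 2 * c) c := by
    unfold selbergIntegral
    refine integral_congr_ae ?_
    filter_upwards [ae_cube n] with t ht
    rw [one_mul, ← mul_assoc]
    congr 1
    unfold density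
    rw [← Finset.prod_mul_distrib]
    refine Finset.prod_congr rfl fun j _ => ?_
    have h := sub_pos.2 (ht j).2
    rw [kernel, weight, weight, add_zero, ← Real.rpow_natCast, ← Real.rpow_mul h.le]
    simp [mul_comm]
  rw [h1, integral_const_mul] at h0
  rw [← h0]
  simp only [one_mul, Finset.sum_const, Finset.card_erase_of_mem (Finset.mem_univ _),
    Finset.card_univ, Fintype.card_fin, Nat.add_sub_cancel, nsmul_eq_mul, selbergIntegral]
  ring

lemma selbergIntegral_symm (n : ℕ) (a b c : ℝ) :
    selbergIntegral n a b c = selbergIntegral n b a c := by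
  unfold selbergIntegral
  rw [cube_eq]
  have hm := Measure.measurePreserving_sub_left (volume : Measure (Fin n → ℝ)) 1
  have := hm.setIntegral_preimage_emb (MeasurableEquiv.subLeft (1 : Fin n → ℝ)).measurableEmbedding
    (fun t => density a b t * interaction 0 c t) (Set.univ.pi fun _ : Fin n => Set.Ioo (0 : ℝ) 1)
  rw [← this]
  have hpre : (fun x : Fin n → ℝ => 1 - x) ⁻¹' (Set.univ.pi fun _ : Fin n => Set.Ioo (0 : ℝ) 1) =
      Set.univ.pi fun _ : Fin n => Set.Ioo (0 : ℝ) 1 := by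
    ext t
    simp [and_comm]
  rw [hpre]
  refine integral_congr_ae (ae_of_all _ fun t => ?_)
  simp [density, interaction, kernel, weight, mul_comm, sub_sq_comm]

lemma selbergIntegral_antitone {a a' b c : ℝ} (ha : 0 < a) (haa : a ≤ a') (hb : 0 < b) (hc : 0 ≤ c)
    (n : ℕ) : selbergIntegral n a' b c ≤ selbergIntegral n a b c := by
  have hint {a : ℝ} (ha : 0 < a) := integrable_mul_density_mul_interaction (ε := 0) (n := n)
    ha hb hc (p := fun _ => 1) continuous_const
  simp only [one_mul] at hint
  refine integral_mono_ae (hint (ha.trans_le haa)) (hint ha) ?_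
  filter_upwards [ae_cube n] with t ht
  refine mul_le_mul_of_nonneg_right ?_ (interaction_nonneg le_rfl c t)
  refine Finset.prod_le_prod (fun i _ => ?_) fun i _ => ?_
  · exact mul_nonneg (Real.rpow_nonneg (ht i).1.le _) (Real.rpow_nonneg (by linarith [(ht i).2]) _)
  · refine mul_le_mul_of_nonneg_right ?_ (Real.rpow_nonneg (by linarith [(ht i).2]) _)
    exact Real.rpow_le_rpow_of_exponent_ge (ht i).1 (ht i).2.le (by linarith)

lemma selbergIntegral_add_one {a b c : ℝ} (ha : 0 < a) (hb : 0 < b) (hc : 0 ≤ c) (n : ℕ) :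
    selbergIntegral n (a + 1) b c = selbergIntegral n a b c *
      ∏ j ∈ Finset.range n, (a + j * c) / (a + b + (n + j - 1) * c) := by
  rcases n with _ | n
  · simp [selbergIntegral, density]
  have key (s : Finset (Fin (n + 1))) : momentIntegral a b c s = selbergIntegral (n + 1) a b c *
      ∏ k ∈ Finset.range s.card, (a + (n - k) * c) / (a + b + (2 * n - k) * c) := by
    induction s using Finset.induction_on with
    | empty => simp [momentIntegral_empty]
    | insert i s hi ih =>
      have hle : (s.card : ℝ) ≤ n := by
        have := (Finset.card_le_univ (insert i s))
        rw [Finset.card_insert_of_notMem hi, Fintype.card_fin] at this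
        exact_mod_cast Nat.le_of_succ_le_succ this
      have hpos : 0 < a + b + (2 * n - s.card) * c := by
        have : 0 ≤ (2 * n - s.card) * c :=
          mul_nonneg (by linarith [(Nat.cast_nonneg n : (0 : ℝ) ≤ n)]) hc
        linarith
      have h := momentIntegral_insert ha hb hc hi
      rw [Finset.card_insert_of_notMem hi, Finset.prod_range_succ, ← mul_assoc, ← ih,
        ← mul_div_assoc, eq_div_iff hpos.ne']
      linear_combination -h
  rw [← momentIntegral_univ, key, Finset.card_univ, Fintype.card_fin,
    ← Finset.prod_range_reflect]
  congr 1
  refine Finset.prod_congr rfl fun j hj => ?_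
  have hj' : j ≤ n := Nat.lt_succ_iff.1 (Finset.mem_range.1 hj)
  rw [Nat.add_sub_cancel, Nat.cast_sub hj']
  push_cast
  congr 2 <;> ring

lemma prod_ratio_pos {a b c : ℝ} (ha : 0 < a) (hb : 0 < b) (hc : 0 ≤ c) (n : ℕ) :
    0 < ∏ j ∈ Finset.range n, (a + j * c) / (a + b + (n + j - 1) * c) := by
  refine Finset.prod_pos fun j hj => ?_
  have hn : (1 : ℝ) ≤ n := by exact_mod_cast (Nat.zero_le j).trans_lt (Finset.mem_range.1 hj)
  have : (0 : ℝ) ≤ (n + j - 1) * c :=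
    mul_nonneg (by linarith [(Nat.cast_nonneg j : (0 : ℝ) ≤ j)]) hc
  positivity

lemma selbergIntegral_pos {a b c : ℝ} (ha : 0 < a) (hb : 0 < b) (hc : 0 ≤ c) (n : ℕ) :
    0 < selbergIntegral n a b c := by
  induction n generalizing a b with
  | zero => simp [selbergIntegral, density, interaction, cube, Measure.real]
  | succ n ih =>
    have h (N : ℕ) : 0 < selbergIntegral (n + 1) (N + 1) a c := by
      induction N with
      | zero =>
        have h1 := ih ha (show 0 < 1 + 2 * c by positivity)
        rw [← selbergIntegral_succ_one ha hc n] at h1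
        rw [selbergIntegral_symm]
        simpa using pos_of_mul_pos_right h1 (by positivity)
      | succ N ihN =>
        rw [Nat.cast_succ, selbergIntegral_add_one (by positivity) ha hc]
        exact mul_pos ihN (prod_ratio_pos (by positivity) ha hc _)
    obtain ⟨N, hN⟩ := exists_nat_ge b
    rw [selbergIntegral_symm]
    exact (h N).trans_le (selbergIntegral_antitone hb (by linarith) ha hc _)

/-- Two positive antitone functions with the same multiplicative increments, tending to one,
are proportional. -/
lemma div_eq_div_of_antitone {f g ρ : ℝ → ℝ} (hf : ∀ x, 0 < x → 0 < f x)
    (hg : ∀ x, 0 < x → 0 < g x)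
    (hfa : ∀ x y, 0 < x → x ≤ y → f y ≤ f x) (hga : ∀ x y, 0 < x → x ≤ y → g y ≤ g x)
    (hfρ : ∀ x, 0 < x → f (x + 1) = f x * ρ x) (hgρ : ∀ x, 0 < x → g (x + 1) = g x * ρ x)
    (hρ : Tendsto ρ atTop (𝓝 1)) {x y : ℝ} (hx : 0 < x) (hy : 0 < y) :
    f x / g x = f y / g y := by
  wlog hxy : x ≤ y generalizing x y
  · exact (this hy hx (le_of_not_ge hxy)).symm
  have hper (z : ℝ) (hz : 0 < z) (m : ℕ) : f (z + m) = f z / g z * g (z + m) := by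
    induction m with
    | zero => simp [div_mul_cancel₀ _ (hg z hz).ne']
    | succ m ih =>
      have : 0 < z + m := by positivity
      rw [Nat.cast_succ, ← add_assoc, hfρ _ this, hgρ _ this, ih]
      ring
  have hlim (N : ℕ) : Tendsto (fun z => g (z + N) / g z) atTop (𝓝 1) := by
    induction N with
    | zero =>
      refine tendsto_const_nhds.congr' ?_
      filter_upwards [eventually_gt_atTop 0] with z hz
      simp [div_self (hg z hz).ne']
    | succ N ih =>
      have h1 := ih.mul (hρ.comp (tendsto_atTop_add_const_right atTop (N : ℝ) tendsto_id))
      rw [mul_one] at h1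
      refine h1.congr' ?_
      filter_upwards [eventually_gt_atTop 0] with z hz
      have : 0 < z + N := by positivity
      simp only [Function.comp_apply, id]
      rw [Nat.cast_succ, ← add_assoc, hgρ _ this]
      ring
  obtain ⟨N, hN⟩ := exists_nat_ge (y - x)
  set q : ℕ → ℝ := fun m => g (x + m + N) / g (x + m)
  have hq : Tendsto q atTop (𝓝 1) :=
    (hlim N).comp (tendsto_atTop_add_const_left atTop x tendsto_natCast_atTop_atTop)
  have hqpos (m : ℕ) : 0 < q m := div_pos (hg _ (by positivity)) (hg _ (by positivity))
  have hyx (m : ℕ) : 0 < x + m ∧ 0 < y + m ∧ x + m ≤ y + m ∧ y + m ≤ x + m + N :=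
    ⟨by positivity, by positivity, by linarith, by linarith⟩
  have hHpos : 0 < f x / g x := div_pos (hf x hx) (hg x hx)
  refine le_antisymm ?_ ?_
  · have h := hq.const_mul (f x / g x)
    rw [mul_one] at h
    refine le_of_tendsto h (Eventually.of_forall fun m => ?_)
    obtain ⟨h1, h2, h3, h4⟩ := hyx m
    have e1 : f x / g x * q m = f (x + m + N) / g (x + m) := by
      rw [add_assoc, ← Nat.cast_add, hper x hx (m + N)]
      simp only [q]
      rw [add_assoc, ← Nat.cast_add]
      ring
    have e2 : f y / g y = f (y + m) / g (y + m) := by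
      rw [hper y hy m, mul_div_cancel_right₀ _ (hg _ h2).ne']
    rw [e1, e2]
    exact div_le_div₀ (hf _ h2).le (hfa _ _ h2 h4) (hg _ h2) (hga _ _ h1 h3)
  · have h := (hq.inv₀ one_ne_zero).const_mul (f x / g x)
    rw [inv_one, mul_one] at h
    refine ge_of_tendsto h (Eventually.of_forall fun m => ?_)
    obtain ⟨h1, h2, h3, h4⟩ := hyx m
    have e1 : f x / g x * (q m)⁻¹ = f (x + m) / g (x + m + N) := by
      rw [hper x hx m]
      simp only [q, inv_div]
      ring
    have e2 : f y / g y = f (y + m) / g (y + m) := by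
      rw [hper y hy m, mul_div_cancel_right₀ _ (hg _ h2).ne']
    rw [e1, e2]
    exact div_le_div₀ (hf _ h1).le (hfa _ _ h1 h3) (hg _ (by positivity)) (hga _ _ h2 h4)

lemma integral_weight {a b : ℝ} (ha : 0 < a) (hb : 0 < b) :
    ∫ x, weight a b x ∂unitMeasure = Real.Gamma a * Real.Gamma b / Real.Gamma (a + b) := by
  have h := Complex.betaIntegral_eq_Gamma_mul_div (a : ℂ) (b : ℂ) (by simpa) (by simpa)
  rw [Complex.betaIntegral, intervalIntegral.integral_of_le zero_le_one,
    integral_Ioc_eq_integral_Ioo] at h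
  have h1 : ∫ x in Set.Ioo (0 : ℝ) 1, (x : ℂ) ^ ((a : ℂ) - 1) * (1 - (x : ℂ)) ^ ((b : ℂ) - 1) =
      ∫ x, ((weight a b x : ℝ) : ℂ) ∂unitMeasure := by
    refine setIntegral_congr_fun measurableSet_Ioo fun x hx => ?_
    simp only [weight]
    push_cast
    rw [Complex.ofReal_cpow hx.1.le, Complex.ofReal_cpow (by linarith [hx.2])]
    push_cast
    rfl
  rw [h1, integral_complex_ofReal, ← Complex.ofReal_add] at h
  simp only [Complex.Gamma_ofReal] at h
  exact_mod_cast h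

lemma gamma_div_gamma_antitone {d x y : ℝ} (hd : 0 < d) (hx : 0 < x) (hxy : x ≤ y) :
    Real.Gamma y / Real.Gamma (y + d) ≤ Real.Gamma x / Real.Gamma (x + d) := by
  have hΓ := Real.Gamma_pos_of_pos hd
  have h : ∫ t, weight y d t ∂unitMeasure ≤ ∫ t, weight x d t ∂unitMeasure := by
    refine integral_mono_ae (integrable_weight (hx.trans_le hxy) hd) (integrable_weight hx hd) ?_
    filter_upwards [ae_unitMeasure] with t ht
    refine mul_le_mul_of_nonneg_right ?_ (Real.rpow_nonneg (by linarith [ht.2]) _)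
    exact Real.rpow_le_rpow_of_exponent_ge ht.1 ht.2.le (by linarith)
  rw [integral_weight (hx.trans_le hxy) hd, integral_weight hx hd, mul_div_right_comm,
    mul_div_right_comm] at h
  exact le_of_mul_le_mul_right h hΓ

/-- The dependence of the Selberg integral on its first two parameters. -/
noncomputable def gammaQuotient (n : ℕ) (a b c : ℝ) : ℝ :=
  ∏ j ∈ Finset.range n, Real.Gamma (a + j * c) * Real.Gamma (b + j * c) /
    Real.Gamma (a + b + (n + j - 1) * c)

lemma gammaQuotient_symm (n : ℕ) (a b c : ℝ) : gammaQuotient n a b c = gammaQuotient n b a c := by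
  unfold gammaQuotient
  refine Finset.prod_congr rfl fun j _ => ?_
  rw [add_comm a b, mul_comm (Real.Gamma (a + j * c))]

lemma shift_nonneg {c : ℝ} (hc : 0 ≤ c) {n j : ℕ} (hj : j ∈ Finset.range n) :
    0 ≤ ((n : ℝ) + j - 1) * c := by
  have hn : (1 : ℝ) ≤ n := by exact_mod_cast (Nat.zero_le j).trans_lt (Finset.mem_range.1 hj)
  exact mul_nonneg (by linarith [(Nat.cast_nonneg j : (0 : ℝ) ≤ j)]) hc

lemma gammaQuotient_pos {a b c : ℝ} (ha : 0 < a) (hb : 0 < b) (hc : 0 ≤ c) (n : ℕ) :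
    0 < gammaQuotient n a b c := by
  refine Finset.prod_pos fun j hj => ?_
  have := shift_nonneg hc hj
  exact div_pos (mul_pos (Real.Gamma_pos_of_pos (by positivity))
    (Real.Gamma_pos_of_pos (by positivity))) (Real.Gamma_pos_of_pos (by positivity))

lemma gammaQuotient_add_one {a b c : ℝ} (ha : 0 < a) (hb : 0 < b) (hc : 0 ≤ c) (n : ℕ) :
    gammaQuotient n (a + 1) b c = gammaQuotient n a b c *
      ∏ j ∈ Finset.range n, (a + j * c) / (a + b + (n + j - 1) * c) := by
  unfold gammaQuotient
  rw [← Finset.prod_mul_distrib]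
  refine Finset.prod_congr rfl fun j hj => ?_
  have h := shift_nonneg hc hj
  rw [show a + 1 + j * c = a + j * c + 1 by ring,
    show a + 1 + b + (n + j - 1) * c = a + b + (n + j - 1) * c + 1 by ring,
    Real.Gamma_add_one (by positivity), Real.Gamma_add_one (by positivity), div_mul_div_comm]
  congr 1 <;> ring

lemma gammaQuotient_antitone {a a' b c : ℝ} (ha : 0 < a) (haa : a ≤ a') (hb : 0 < b) (hc : 0 ≤ c)
    (n : ℕ) : gammaQuotient n a' b c ≤ gammaQuotient n a b c := by
  have ha' := ha.trans_le haa
  unfold gammaQuotient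
  refine Finset.prod_le_prod (fun j hj => ?_) fun j hj => ?_
  · have := shift_nonneg hc hj
    exact (div_pos (mul_pos (Real.Gamma_pos_of_pos (by positivity))
      (Real.Gamma_pos_of_pos (by positivity))) (Real.Gamma_pos_of_pos (by positivity))).le
  · have hn : (1 : ℝ) ≤ n := by exact_mod_cast (Nat.zero_le j).trans_lt (Finset.mem_range.1 hj)
    have hd : 0 < b + (n - 1) * c := by
      have : 0 ≤ ((n : ℝ) - 1) * c := mul_nonneg (by linarith) hc
      positivity
    have h := gamma_div_gamma_antitone hd (show 0 < a + j * c by positivity)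
      (show a + j * c ≤ a' + j * c by linarith)
    rw [show a' + j * c + (b + (n - 1) * c) = a' + b + (n + j - 1) * c by ring,
      show a + j * c + (b + (n - 1) * c) = a + b + (n + j - 1) * c by ring] at h
    rw [mul_div_right_comm, mul_div_right_comm]
    exact mul_le_mul_of_nonneg_right h (Real.Gamma_pos_of_pos (by positivity)).le

lemma tendsto_add_div_add (u v : ℝ) : Tendsto (fun x : ℝ => (x + u) / (x + v)) atTop (𝓝 1) := by
  have h : Tendsto (fun x : ℝ => 1 + (u - v) / (x + v)) atTop (𝓝 (1 + 0)) :=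
    tendsto_const_nhds.add
      (tendsto_const_nhds.div_atTop (tendsto_atTop_add_const_right atTop v tendsto_id))
  rw [add_zero] at h
  refine h.congr' ?_
  filter_upwards [eventually_gt_atTop (-v)] with x hx
  have : x + v ≠ 0 := by linarith
  field_simp
  ring

lemma selbergIntegral_div_gammaQuotient {a a' b c : ℝ} (ha : 0 < a) (ha' : 0 < a') (hb : 0 < b)
    (hc : 0 ≤ c) (n : ℕ) :
    selbergIntegral n a b c / gammaQuotient n a b c =
      selbergIntegral n a' b c / gammaQuotient n a' b c := by
  refine div_eq_div_of_antitone (f := fun x => selbergIntegral n x b c)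
    (g := fun x => gammaQuotient n x b c)
    (ρ := fun x => ∏ j ∈ Finset.range n, (x + j * c) / (x + b + (n + j - 1) * c))
    (fun x hx => selbergIntegral_pos hx hb hc n) (fun x hx => gammaQuotient_pos hx hb hc n)
    (fun x y hx hxy => selbergIntegral_antitone hx hxy hb hc n)
    (fun x y hx hxy => gammaQuotient_antitone hx hxy hb hc n)
    (fun x hx => selbergIntegral_add_one hx hb hc n)
    (fun x hx => gammaQuotient_add_one hx hb hc n) ?_ ha ha'
  have h := tendsto_finsetProd (Finset.range n) fun j _ =>
    tendsto_add_div_add (j * c) (b + (n + j - 1) * c)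
  simpa only [← add_assoc, Finset.prod_const_one] using h

lemma selbergIntegral_eq_mul_gammaQuotient {a b c : ℝ} (ha : 0 < a) (hb : 0 < b) (hc : 0 ≤ c)
    (n : ℕ) : selbergIntegral n a b c =
      selbergIntegral n 1 1 c / gammaQuotient n 1 1 c * gammaQuotient n a b c := by
  rw [← div_eq_iff (gammaQuotient_pos ha hb hc n).ne',
    selbergIntegral_div_gammaQuotient ha one_pos hb hc, selbergIntegral_symm, gammaQuotient_symm,
    selbergIntegral_div_gammaQuotient hb one_pos one_pos hc]

lemma gammaQuotient_one_step {c : ℝ} (hc : 0 ≤ c) (n : ℕ) :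
    (1 + n * c) * (Real.Gamma (1 + (n + 1) * c) / Real.Gamma (1 + c)) *
      gammaQuotient (n + 1) 1 1 c = gammaQuotient n 1 (1 + 2 * c) c := by
  have hΓ (k : ℕ) : Real.Gamma (1 + k * c) ≠ 0 := (Real.Gamma_pos_of_pos (by positivity)).ne'
  have hΓ1 := hΓ 1
  have hΓn : Real.Gamma (1 + (n + 1) * c) ≠ 0 := by exact_mod_cast hΓ (n + 1)
  rw [Nat.cast_one, one_mul] at hΓ1
  unfold gammaQuotient
  rw [Finset.prod_div_distrib, Finset.prod_div_distrib, Finset.prod_mul_distrib,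
    Finset.prod_mul_distrib, Finset.prod_range_succ (fun j : ℕ => Real.Gamma (1 + j * c)) n,
    Finset.prod_range_succ' (fun j : ℕ => Real.Gamma (1 + 1 + (((n + 1 : ℕ) : ℝ) + j - 1) * c)) n]
  have hshift : Real.Gamma (1 + (n + 1) * c) *
      ((∏ j ∈ Finset.range n, Real.Gamma (1 + j * c)) * Real.Gamma (1 + n * c)) =
      Real.Gamma (1 + c) * ∏ j ∈ Finset.range n, Real.Gamma (1 + 2 * c + j * c) := by
    have h := Finset.prod_range_succ (fun j : ℕ => Real.Gamma (1 + j * c)) (n + 1)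
    rw [Finset.prod_range_succ', Finset.prod_range_succ', Finset.prod_range_succ] at h
    have e (j : ℕ) : Real.Gamma (1 + 2 * c + j * c) = Real.Gamma (1 + (j + 1 + 1 : ℕ) * c) := by
      congr 1; push_cast; ring
    simp only [e]
    simp only [Nat.cast_add, Nat.cast_one, Nat.cast_zero, zero_mul, zero_add, add_zero, one_mul,
      Real.Gamma_one, mul_one] at h ⊢
    rw [mul_comm, ← h, mul_comm]
  have hden : ∏ j ∈ Finset.range n, Real.Gamma (1 + 1 + (((n + 1 : ℕ) : ℝ) + (j + 1 : ℕ) - 1) * c) =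
      ∏ j ∈ Finset.range n, Real.Gamma (1 + (1 + 2 * c) + ((n : ℝ) + j - 1) * c) := by
    refine Finset.prod_congr rfl fun j _ => ?_
    congr 1; push_cast; ring
  have hlast : Real.Gamma (1 + 1 + (((n + 1 : ℕ) : ℝ) + (0 : ℕ) - 1) * c) =
      (1 + n * c) * Real.Gamma (1 + n * c) := by
    rw [← Real.Gamma_add_one (by positivity)]
    congr 1; push_cast; ring
  have hden0 : ∏ j ∈ Finset.range n, Real.Gamma (1 + (1 + 2 * c) + ((n : ℝ) + j - 1) * c) ≠ 0 := by
    refine Finset.prod_ne_zero_iff.2 fun j hj => (Real.Gamma_pos_of_pos ?_).ne'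
    have := shift_nonneg hc hj
    positivity
  have hn : Real.Gamma (1 + n * c) ≠ 0 := hΓ n
  have hK : 1 + n * c ≠ 0 := by positivity
  rw [hden, hlast]
  generalize Real.Gamma (1 + (n + 1) * c) = x at *
  generalize Real.Gamma (1 + c) = y at *
  generalize Real.Gamma (1 + n * c) = z at *
  generalize ∏ j ∈ Finset.range n, Real.Gamma (1 + (1 + 2 * c) + ((n : ℝ) + j - 1) * c) = d at *
  generalize ∏ j ∈ Finset.range n, Real.Gamma (1 + 2 * c + j * c) = q at *
  generalize ∏ j ∈ Finset.range n, Real.Gamma (1 + j * c) = p at *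
  generalize 1 + n * c = k at *
  field_simp
  linear_combination p * hshift

lemma selbergIntegral_eq {a b c : ℝ} (ha : 0 < a) (hb : 0 < b) (hc : 0 ≤ c) (n : ℕ) :
    selbergIntegral n a b c =
      (∏ j ∈ Finset.range n, Real.Gamma (1 + (j + 1) * c) / Real.Gamma (1 + c)) *
        gammaQuotient n a b c := by
  induction n generalizing a b with
  | zero => simp [selbergIntegral, density, interaction, cube, gammaQuotient, Measure.real]
  | succ n ih =>
    have h1 := selbergIntegral_succ_one one_pos hc n
    rw [ih one_pos (by positivity), ← gammaQuotient_one_step hc n] at h1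
    have hn' : (1 : ℝ) + n * c ≠ 0 := by positivity
    rw [selbergIntegral_eq_mul_gammaQuotient ha hb hc, Finset.prod_range_succ]
    congr 1
    rw [div_eq_iff (gammaQuotient_pos one_pos one_pos hc _).ne']
    refine mul_left_cancel₀ hn' ?_
    rw [h1]
    ring

lemma interaction_zero_eq {c : ℝ} (hc : 0 ≤ c) {n : ℕ} (t : Fin n → ℝ) :
    interaction 0 c t = ∏ p ∈ Finset.univ.filter (fun p : Fin n × Fin n => p.1 < p.2),
      |t p.1 - t p.2| ^ (2 * c) := by
  have hk (x y : ℝ) : kernel 0 (c / 2) x y = |x - y| ^ c := by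
    rw [kernel, add_zero, ← sq_abs, ← Real.rpow_natCast, ← Real.rpow_mul (abs_nonneg _)]
    congr 1
    push_cast
    ring
  unfold interaction
  simp only [hk]
  rw [← Finset.prod_product', Finset.univ_product_univ]
  have hsplit (p : Fin n × Fin n) : (if p.1 = p.2 then 1 else |t p.1 - t p.2| ^ c) =
      (if p.1 < p.2 then |t p.1 - t p.2| ^ c else 1) *
        (if p.2 < p.1 then |t p.2 - t p.1| ^ c else 1) := by
    rcases lt_trichotomy p.1 p.2 with h | h | h
    · simp [h, h.ne, h.not_gt]
    · simp [h]
    · simp [h, h.ne', h.not_gt, abs_sub_comm]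
  simp only [hsplit]
  rw [Finset.prod_mul_distrib, ← Equiv.prod_comp (Equiv.prodComm (Fin n) (Fin n))
    (fun p => if p.2 < p.1 then |t p.2 - t p.1| ^ c else 1)]
  simp only [Equiv.prodComm_apply, Prod.fst_swap, Prod.snd_swap]
  rw [← Finset.prod_mul_distrib, Finset.prod_filter]
  refine Finset.prod_congr rfl fun p _ => ?_
  by_cases h : p.1 < p.2
  · simp only [h, if_true, two_mul, Real.rpow_add_of_nonneg (abs_nonneg _) hc hc]
  · simp [h]

end Selberg

/-- **The Selberg integral formula.**  For every positive integer `n` and all real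
`α > 0`, `β > 0`, `γ ≥ 0`, the function
`t ↦ ∏_{i=1}^n tᵢ^(α-1) (1-tᵢ)^(β-1) · ∏_{1 ≤ i < j ≤ n} |tᵢ - tⱼ|^(2γ)`
is (Lebesgue-)integrable on the unit cube `[0,1]^n ⊆ ℝ^n`, and its integral equals
`∏_{j=0}^{n-1} Γ(α + jγ) Γ(β + jγ) Γ(1 + (j+1)γ) / (Γ(α + β + (n+j-1)γ) Γ(1 + γ))`. -/
theorem selberg_integral_formula (n : ℕ) (hn : 0 < n) (α β γ : ℝ)
    (hα : 0 < α) (hβ : 0 < β) (hγ : 0 ≤ γ) :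
    MeasureTheory.IntegrableOn
      (fun t : Fin n → ℝ =>
        (∏ i, t i ^ (α - 1) * (1 - t i) ^ (β - 1)) *
        ∏ p ∈ Finset.univ.filter (fun p : Fin n × Fin n => p.1 < p.2),
          |t p.1 - t p.2| ^ (2 * γ))
      (Set.Icc 0 1) MeasureTheory.volume ∧
    ∫ t in Set.Icc (0 : Fin n → ℝ) 1,
        (∏ i, t i ^ (α - 1) * (1 - t i) ^ (β - 1)) *
        ∏ p ∈ Finset.univ.filter (fun p : Fin n × Fin n => p.1 < p.2),
          |t p.1 - t p.2| ^ (2 * γ) =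
      ∏ j ∈ Finset.range n,
        Real.Gamma (α + j * γ) * Real.Gamma (β + j * γ) * Real.Gamma (1 + (j + 1) * γ) /
          (Real.Gamma (α + β + ((n : ℝ) + j - 1) * γ) * Real.Gamma (1 + γ)) := by
  have hfun : (fun t : Fin n → ℝ =>
        (∏ i, t i ^ (α - 1) * (1 - t i) ^ (β - 1)) *
        ∏ p ∈ Finset.univ.filter (fun p : Fin n × Fin n => p.1 < p.2),
          |t p.1 - t p.2| ^ (2 * γ)) =
      fun t => Selberg.density α β t * Selberg.interaction 0 γ t :=
    funext fun t => by
      rw [Selberg.interaction_zero_eq hγ]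
      rfl
  have hcube : volume.restrict (Set.Icc (0 : Fin n → ℝ) 1) = Selberg.cube n := by
    rw [Selberg.cube_eq]
    exact (Measure.restrict_congr_set (Measure.univ_pi_Ioo_ae_eq_Icc (f := 0) (g := 1))).symm
  rw [IntegrableOn, hfun, hcube]
  constructor
  · simpa using Selberg.integrable_mul_density_mul_interaction (ε := 0) (n := n) hα hβ hγ
      (p := fun _ => 1) continuous_const
  · refine (Selberg.selbergIntegral_eq hα hβ hγ n).trans ?_
    rw [Selberg.gammaQuotient, ← Finset.prod_mul_distrib]
    refine Finset.prod_congr rfl fun j _ => ?_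
    rw [div_mul_div_comm]
    congr 1 <;> ring
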